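/- Plaquette decomposition and gap for the hard-core Bose-Hubbard interaction: for every occupation configuration n_P ∈ {0,1}^P on a 2×2 plaquette P ⊂ ℤ², the plaquette interaction Φ_P(n_P) = (U₁/2) ∑_{x,y∈P, ‖x−y‖₂=1} n_x n_y + U₂ ∑_{x,y∈P, ‖x−y‖₂=√2} n_x n_y − (μ/4) ∑_{x∈P} n_x satisfies the identity Φ_P(n_P) = (U₁/4 − U₂/2) ∑_{x,y∈P, ‖x−y‖₂=1} (n_x + n_y − 1/2)² + U₂ (∑_{x∈P} n_x − 1/2 − μ/(8U₂))² + C with C = −U₁/2 + 3U₂/4 − μ/8 − μ²/(64U₂). Consequently, if U₁ ≥ 2U₂ and 0 < μ < 8U₂, the minimizers of Φ_P over {0,1}^P are exactly the four configurations with a single occupied site, and Φ_P(n_P) − Φ_P(g_P) ≥ (1/4) min(μ, 8U₂ − μ) for every non-minimizing n_P and every minimizer g_P. -/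

import Mathlib

open scoped BigOperators
open Classical

/-!  Plaquette decomposition and gap for the classical interaction of the hard-core
Bose–Hubbard model (Kotecký–Ueltschi, "Effective interactions due to quantum
fluctuations", Section 3.2). -/

namespace BoseHubbardPlaquette

noncomputable section

/-- A `2×2` plaquette. -/
abbrev Plaq := Fin 2 × Fin 2

/-- Two plaquette sites at Euclidean distance `1` (they differ in exactly one
coordinate). -/
def nb (p q : Plaq) : Prop := (p.1 = q.1 ∧ p.2 ≠ q.2) ∨ (p.1 ≠ q.1 ∧ p.2 = q.2)

/-- Two plaquette sites at Euclidean distance `√2` (they differ in both coordinates). -/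
def dg (p q : Plaq) : Prop := p.1 ≠ q.1 ∧ p.2 ≠ q.2

/-- The occupation number `n_p ∈ {0,1}` as a real number. -/
def occ (n : Plaq → Bool) (p : Plaq) : ℝ := if n p then 1 else 0

/-- The plaquette interaction
`Φ_P(n_P) = (U₁/2) ∑_{x,y∈P, ‖x-y‖₂=1} n_x n_y + U₂ ∑_{x,y∈P, ‖x-y‖₂=√2} n_x n_y`
`           - (μ/4) ∑_{x∈P} n_x` (sums over ordered pairs). -/
def ΦP (U₁ U₂ μ : ℝ) (n : Plaq → Bool) : ℝ :=
  U₁ / 2 * (∑ p : Plaq, ∑ q : Plaq, if nb p q then occ n p * occ n q else 0)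
  + U₂ * (∑ p : Plaq, ∑ q : Plaq, if dg p q then occ n p * occ n q else 0)
  - μ / 4 * (∑ p : Plaq, occ n p)

/-- The number of occupied sites of a plaquette configuration. -/
def occNum (n : Plaq → Bool) : ℕ := (Finset.univ.filter fun p => n p = true).card

theorem occ_sq (n : Plaq → Bool) (p : Plaq) : occ n p ^ 2 = occ n p := by
  unfold occ; split_ifs <;> norm_num

theorem ΦP_eq (U₁ U₂ μ : ℝ) (n : Plaq → Bool) : ΦP U₁ U₂ μ n =
    U₁ * (occ n (0,0) * occ n (0,1) + occ n (0,0) * occ n (1,0)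
      + occ n (1,1) * occ n (0,1) + occ n (1,1) * occ n (1,0))
    + 2 * U₂ * (occ n (0,0) * occ n (1,1) + occ n (0,1) * occ n (1,0))
    - μ / 4 * (occ n (0,0) + occ n (0,1) + occ n (1,0) + occ n (1,1)) := by
  simp only [ΦP, nb, dg, Fintype.sum_prod_type, Fin.sum_univ_two]
  simp
  ring

theorem occNum_eq (n : Plaq → Bool) : occNum n =
    (if n (0,0) then 1 else 0) + (if n (0,1) then 1 else 0)
    + (if n (1,0) then 1 else 0) + (if n (1,1) then 1 else 0) := by
  simp only [occNum, Finset.card_filter, Fintype.sum_prod_type, Fin.sum_univ_two]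
  ring

theorem ΦP_one (U₁ U₂ μ : ℝ) (n : Plaq → Bool) (h : occNum n = 1) :
    ΦP U₁ U₂ μ n = - μ / 4 := by
  rw [occNum_eq] at h
  rw [ΦP_eq]
  simp only [occ]
  cases h1 : n (0,0) <;> cases h2 : n (0,1) <;> cases h3 : n (1,0) <;> cases h4 : n (1,1) <;>
    simp [h1, h2, h3, h4] at h ⊢ <;> ring

theorem ΦP_gap (U₁ U₂ μ : ℝ) (a : 2 * U₂ ≤ U₁) (b : 0 < μ) (c : μ < 8 * U₂)
    (n : Plaq → Bool) (h : occNum n ≠ 1) :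
    (1 / 4) * min μ (8 * U₂ - μ) ≤ ΦP U₁ U₂ μ n + μ / 4 := by
  have m1 := min_le_left μ (8 * U₂ - μ)
  have m2 := min_le_right μ (8 * U₂ - μ)
  rw [occNum_eq] at h
  rw [ΦP_eq]
  simp only [occ]
  cases h1 : n (0,0) <;> cases h2 : n (0,1) <;> cases h3 : n (1,0) <;> cases h4 : n (1,1) <;>
    first
    | (exfalso; simp [h1, h2, h3, h4] at h; done)
    | (clear h
       simp only [h1, h2, h3, h4, if_true, Bool.false_eq_true, if_false]
       linarith)

/-- Plaquette decomposition and gap for the hard-core Bose–Hubbard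
interaction.

For every `n_P ∈ {0,1}^P` on a `2×2` plaquette,
`Φ_P(n_P) = (U₁/4 − U₂/2) ∑_{‖x−y‖₂=1} (n_x + n_y − 1/2)²`
`           + U₂ (∑_{x∈P} n_x − 1/2 − μ/(8U₂))² + C`
with `C = −U₁/2 + 3U₂/4 − μ/8 − μ²/(64U₂)`.  Consequently, if `U₁ ≥ 2U₂` and
`0 < μ < 8U₂`, the minimizers of `Φ_P` over `{0,1}^P` are exactly the four
configurations with a single occupied site, and
`Φ_P(n_P) − Φ_P(g_P) ≥ (1/4) min(μ, 8U₂ − μ)` for every non-minimizing `n_P` and every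
minimizer `g_P`. -/
theorem plaquette_decomposition_and_gap (U₁ U₂ μ : ℝ) (hU₂ : U₂ ≠ 0) :
    -- the algebraic identity
    (∀ n : Plaq → Bool,
      ΦP U₁ U₂ μ n =
        (U₁ / 4 - U₂ / 2) *
            (∑ p : Plaq, ∑ q : Plaq,
              if nb p q then (occ n p + occ n q - 1 / 2) ^ 2 else 0)
          + U₂ * ((∑ p : Plaq, occ n p) - 1 / 2 - μ / (8 * U₂)) ^ 2
          + (-U₁ / 2 + 3 * U₂ / 4 - μ / 8 - μ ^ 2 / (64 * U₂))) ∧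
    -- the consequences under `U₁ ≥ 2U₂`, `0 < μ < 8U₂`
    (2 * U₂ ≤ U₁ → 0 < μ → μ < 8 * U₂ →
      -- the minimizers are exactly the singly occupied configurations
      ((∀ n : Plaq → Bool,
          (∀ m : Plaq → Bool, ΦP U₁ U₂ μ n ≤ ΦP U₁ U₂ μ m) ↔ occNum n = 1) ∧
        -- the energy gap
        (∀ n g : Plaq → Bool, occNum g = 1 → occNum n ≠ 1 →
          (1 / 4) * min μ (8 * U₂ - μ) ≤ ΦP U₁ U₂ μ n - ΦP U₁ U₂ μ g))) := by
  refine ⟨fun n => ?_, fun a b c => ⟨fun n => ⟨fun h => ?_, fun h m => ?_⟩, fun n g hg hn => ?_⟩⟩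
  · rw [ΦP_eq]
    simp only [nb, Fintype.sum_prod_type, Fin.sum_univ_two]
    simp
    have e1 := occ_sq n (0,0)
    have e2 := occ_sq n (0,1)
    have e3 := occ_sq n (1,0)
    have e4 := occ_sq n (1,1)
    generalize occ n (0,0) = x1 at *
    generalize occ n (0,1) = x2 at *
    generalize occ n (1,0) = x3 at *
    generalize occ n (1,1) = x4 at *
    field_simp
    ring_nf
    simp only [e1, e2, e3, e4]
    ring
  · by_contra hn
    have h1 := ΦP_gap U₁ U₂ μ a b c n hn
    have h2 := h (fun p => decide (p = (0,0)))
    rw [ΦP_one U₁ U₂ μ (fun p => decide (p = (0,0))) (by rw [occNum_eq]; simp)] at h2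
    have : 0 < min μ (8 * U₂ - μ) := lt_min b (by linarith)
    linarith
  · rw [ΦP_one U₁ U₂ μ n h]
    by_cases hm : occNum m = 1
    · rw [ΦP_one U₁ U₂ μ m hm]
    · have h1 := ΦP_gap U₁ U₂ μ a b c m hm
      have : 0 < min μ (8 * U₂ - μ) := lt_min b (by linarith)
      linarith
  · have h1 := ΦP_gap U₁ U₂ μ a b c n hn
    rw [ΦP_one U₁ U₂ μ g hg]
    linarith

end

end BoseHubbardPlaquette
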